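/- Let λ ∈ (0,1), θ ∈ (0,1) with θ(λ+1) < 1, set x_± = (√(θ(1-λθ)) ± √(λθ(1-θ)))² and g(x) = √((x - x_-)(x_+ - x))/(2πλθ·x(1-x)). Then ∫_{x_-}^{x_+} log(x)·g(x) dx = [θ·log θ + (1-λθ)log(1-λθ) - θ(1-λ)log(θ(1-λ))]/(λθ). -/

import Mathlib

theorem sq_add_two_mul_cos_add_sq_pos {p q : ℝ} (hq : |q| < p) (φ : ℝ) :
    0 < p ^ 2 + 2 * p * q * Real.cos φ + q ^ 2 := by
  have hp : 0 < p := (abs_nonneg q).trans_lt hq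
  have h1 : |q * Real.cos φ| ≤ |q| := by
    rw [abs_mul]
    exact mul_le_of_le_one_right (abs_nonneg q) (Real.abs_cos_le_one φ)
  nlinarith [neg_abs_le (q * Real.cos φ), sq_abs q, sq_pos_of_pos (sub_pos.2 hq)]

open intervalIntegral in
/-- The Poisson integral formula on the unit circle for `z ↦ log ‖p + q z‖²` at a real point `w`. -/
theorem integral_poissonKernel_mul_log {p q w : ℝ} (hq : |q| < p) (hw : |w| < 1) :
    ∫ φ in (0 : ℝ)..2 * Real.pi, (1 - w ^ 2) / (1 - 2 * w * Real.cos φ + w ^ 2) *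
      Real.log (p ^ 2 + 2 * p * q * Real.cos φ + q ^ 2) = 4 * Real.pi * Real.log (p + q * w) := by
  have hne : ∀ z ∈ Metric.closedBall (0 : ℂ) 1, (p : ℂ) + q * z ≠ 0 := by
    intro z hz h
    have hz' : ‖z‖ ≤ 1 := by simpa using hz
    have h1 : ‖(p : ℂ)‖ = ‖(q : ℂ) * z‖ := by rw [eq_neg_of_add_eq_zero_left h, norm_neg]
    rw [norm_mul, Complex.norm_real, Complex.norm_real, Real.norm_eq_abs, Real.norm_eq_abs] at h1
    nlinarith [le_abs_self p, abs_nonneg q]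
  have harm : InnerProductSpace.HarmonicOnNhd (fun z : ℂ ↦ Real.log ‖(p : ℂ) + q * z‖)
      (Metric.closedBall 0 1) := fun z hz ↦
    AnalyticAt.harmonicAt_log_norm (f := fun z : ℂ ↦ (p : ℂ) + q * z) (by fun_prop) (hne z hz)
  have key := harm.circleAverage_poissonKernel_smul (w := (w : ℂ)) (by simpa using hw)
  rw [Real.circleAverage_def, smul_eq_mul, inv_mul_eq_iff_eq_mul₀ (by positivity)] at key
  have hpos : 0 < p + q * w := by
    have := abs_mul q w
    nlinarith [neg_abs_le (q * w), abs_nonneg q]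
  have hval : ‖(p : ℂ) + q * w‖ = p + q * w := by
    rw [← Complex.ofReal_mul, ← Complex.ofReal_add, Complex.norm_real, Real.norm_of_nonneg hpos.le]
  rw [hval] at key
  have hnorm : ∀ a b φ : ℝ, ‖(a : ℂ) + b * circleMap 0 1 φ‖ ^ 2 =
      a ^ 2 + 2 * a * b * Real.cos φ + b ^ 2 := by
    intro a b φ
    rw [← Complex.normSq_eq_norm_sq, Complex.normSq_apply]
    simp [circleMap, Complex.exp_ofReal_mul_I_re, Complex.exp_ofReal_mul_I_im]
    linear_combination b ^ 2 * Real.sin_sq_add_cos_sq φ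
  calc _ = ∫ φ in (0 : ℝ)..2 * Real.pi, 2 * (poissonKernel 0 (w : ℂ) •
            fun z : ℂ ↦ Real.log ‖(p : ℂ) + q * z‖) (circleMap 0 1 φ) := by
        refine integral_congr fun φ _ ↦ ?_
        have h : 1 - 2 * w * Real.cos φ + w ^ 2 = ‖circleMap 0 1 φ - (w : ℂ)‖ ^ 2 := by
          rw [show circleMap 0 1 φ - (w : ℂ) = ((-w : ℝ) : ℂ) + (1 : ℝ) * circleMap 0 1 φ by
            push_cast; ring, hnorm]
          ring
        simp only [Pi.smul_apply', smul_eq_mul, poissonKernel_def, sub_zero, h, ← hnorm,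
          Real.log_pow]
        simp
        ring
    _ = _ := by rw [integral_const_mul, key]; ring

open intervalIntegral in
/-- The integral over a full period of a function of `cos` is twice that over `[0, π]`. -/
theorem integral_comp_cos_zero_two_pi {F : ℝ → ℝ} (hF : Continuous fun φ ↦ F (Real.cos φ)) :
    ∫ φ in (0 : ℝ)..2 * Real.pi, F (Real.cos φ) =
      2 * ∫ φ in (0 : ℝ)..Real.pi, F (Real.cos φ) := by
  rw [← integral_add_adjacent_intervals (hF.intervalIntegrable 0 Real.pi)
    (hF.intervalIntegrable Real.pi _)]
  have h := integral_comp_sub_left (a := 0) (b := Real.pi) (fun φ ↦ F (Real.cos φ)) (2 * Real.pi)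
  simp only [Real.cos_two_pi_sub, sub_zero] at h
  rw [show 2 * Real.pi - Real.pi = Real.pi by ring] at h
  rw [← h]; ring

open intervalIntegral in
/-- The substitution `x = m + n cos φ`. -/
theorem integral_sub_add_eq_integral_cos {f : ℝ → ℝ} {m n : ℝ} (hn : 0 ≤ n) :
    ∫ x in (m - n)..(m + n), f x =
      ∫ φ in (0 : ℝ)..Real.pi, f (m + n * Real.cos φ) * (n * Real.sin φ) := by
  have h := integral_comp_mul_deriv_of_deriv_nonpos (a := 0) (b := Real.pi) (g := f)
    (f := fun φ ↦ m + n * Real.cos φ) (f' := fun φ ↦ n * -Real.sin φ) (by fun_prop)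
    (fun φ _ ↦ ((Real.hasDerivAt_cos φ).const_mul n).const_add m) (by
      intro φ hφ
      rw [min_eq_left Real.pi_pos.le, max_eq_right Real.pi_pos.le] at hφ
      have := Real.sin_nonneg_of_nonneg_of_le_pi hφ.1.le hφ.2.le
      nlinarith [mul_nonneg hn this])
  simp only [Real.cos_zero, Real.cos_pi, mul_one, mul_neg, ← sub_eq_add_neg] at h
  rw [integral_symm, ← h, ← integral_neg]
  simp

theorem continuous_poissonKernel_mul_log {p q w : ℝ} (hq : |q| < p) (hw : |w| < 1) :
    Continuous fun φ ↦ (1 - w ^ 2) / (1 - 2 * w * Real.cos φ + w ^ 2) *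
      Real.log (p ^ 2 + 2 * p * q * Real.cos φ + q ^ 2) := by
  have h1 : ∀ φ : ℝ, 1 - 2 * w * Real.cos φ + w ^ 2 ≠ 0 := fun φ ↦ by
    have := sq_add_two_mul_cos_add_sq_pos (p := 1) (q := -w) (by rwa [abs_neg]) φ
    nlinarith
  have h2 : ∀ φ : ℝ, p ^ 2 + 2 * p * q * Real.cos φ + q ^ 2 ≠ 0 := fun φ ↦
    (sq_add_two_mul_cos_add_sq_pos hq φ).ne'
  fun_prop (disch := assumption)

theorem integral_zero_pi_poissonKernel_mul_log {p q w : ℝ} (hq : |q| < p) (hw : |w| < 1) :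
    ∫ φ in (0 : ℝ)..Real.pi, (1 - w ^ 2) / (1 - 2 * w * Real.cos φ + w ^ 2) *
      Real.log (p ^ 2 + 2 * p * q * Real.cos φ + q ^ 2) = 2 * Real.pi * Real.log (p + q * w) := by
  have h := integral_comp_cos_zero_two_pi (F := fun c ↦ (1 - w ^ 2) / (1 - 2 * w * c + w ^ 2) *
    Real.log (p ^ 2 + 2 * p * q * c + q ^ 2)) (continuous_poissonKernel_mul_log hq hw)
  rw [integral_poissonKernel_mul_log hq hw] at h
  linarith

/-- For `λ ∈ (0,1)`, `θ ∈ (0,1)` with `θ(λ+1) < 1`, the density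
`g(x) = √((x-x_-)(x_+-x))/(2πλθ·x(1-x))` of the stationary free Jacobi law satisfies
`∫_{x_-}^{x_+} log(x)·g(x) dx
  = [θ·log θ + (1-λθ)log(1-λθ) - θ(1-λ)log(θ(1-λ))]/(λθ)`. -/
theorem stmt_9 (lam θ : ℝ) (hlam0 : 0 < lam) (hlam1 : lam < 1)
    (hθ0 : 0 < θ) (hθ1 : θ < 1) (hθlam : θ * (lam + 1) < 1)
    (xp xm : ℝ) (g : ℝ → ℝ)
    (hxp : xp = (Real.sqrt (θ * (1 - lam * θ)) + Real.sqrt (lam * θ * (1 - θ))) ^ 2)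
    (hxm : xm = (Real.sqrt (θ * (1 - lam * θ)) - Real.sqrt (lam * θ * (1 - θ))) ^ 2)
    (hg : ∀ x : ℝ, g x =
      Real.sqrt ((x - xm) * (xp - x)) / (2 * Real.pi * lam * θ * x * (1 - x))) :
    (∫ x in xm..xp, Real.log x * g x) =
      (θ * Real.log θ + (1 - lam * θ) * Real.log (1 - lam * θ) -
        θ * (1 - lam) * Real.log (θ * (1 - lam))) / (lam * θ) := by
  have hlt : lam * θ < 1 := by nlinarith
  have hD : 0 < θ * (1 - lam) := mul_pos hθ0 (by linarith)
  have hE : 0 < 1 - θ - lam * θ := by linarith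
  have hR : 0 < (1 - θ) * (1 - lam * θ) := mul_pos (by linarith) (by linarith)
  have hA : 0 < θ * (1 - lam * θ) := mul_pos hθ0 (by linarith)
  have hB : 0 < lam * θ * (1 - θ) := mul_pos (by positivity) (by linarith)
  have hp : 0 < √(θ * (1 - lam * θ)) := Real.sqrt_pos.2 hA
  have hq : 0 < √(lam * θ * (1 - θ)) := Real.sqrt_pos.2 hB
  have hp2 := Real.sq_sqrt hA.le
  have hq2 := Real.sq_sqrt hB.le
  have hlogp : Real.log √(θ * (1 - lam * θ)) = (Real.log θ + Real.log (1 - lam * θ)) / 2 := by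
    rw [Real.log_sqrt hA.le, Real.log_mul hθ0.ne' (by linarith)]
  generalize √(θ * (1 - lam * θ)) = p at *
  generalize √(lam * θ * (1 - θ)) = q at *
  generalize hRdef : (1 - θ) * (1 - lam * θ) = R at *
  have hqp : |q| < p := by
    rw [abs_of_pos hq]
    nlinarith
  obtain ⟨u, hu⟩ : ∃ u, u = -q / p := ⟨_, rfl⟩
  obtain ⟨w, hw⟩ : ∃ w, w = p * q / R := ⟨_, rfl⟩
  have hup : p * u = -q := by rw [hu]; field_simp
  have hwR : R * w = p * q := by rw [hw]; field_simp
  have hw2 : R * w ^ 2 = lam * θ ^ 2 := by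
    apply mul_left_cancel₀ hR.ne'
    calc R * (R * w ^ 2) = p ^ 2 * q ^ 2 := by linear_combination (R * w + p * q) * hwR
      _ = _ := by rw [hp2, hq2, ← hRdef]; ring
  have hu1 : |u| < 1 := by
    rw [hu, abs_div, abs_neg, abs_of_pos hp, div_lt_one hp]
    exact hqp
  have hw1 : |w| < 1 := by
    rw [← sq_lt_one_iff_abs_lt_one]
    nlinarith
  have h01 : |(0 : ℝ)| < 1 := by simp
  have hxp' : xp = p ^ 2 + q ^ 2 + 2 * p * q := by rw [hxp]; ring
  have hxm' : xm = p ^ 2 + q ^ 2 - 2 * p * q := by rw [hxm]; ring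
  have hpt : ∀ φ ∈ Set.uIcc 0 Real.pi,
      Real.log (p ^ 2 + q ^ 2 + 2 * p * q * Real.cos φ) *
        g (p ^ 2 + q ^ 2 + 2 * p * q * Real.cos φ) * (2 * p * q * Real.sin φ) =
      (2 * Real.pi * lam * θ)⁻¹ *
        ((1 - 0 ^ 2) / (1 - 2 * 0 * Real.cos φ + 0 ^ 2) *
            Real.log (p ^ 2 + 2 * p * q * Real.cos φ + q ^ 2) -
          θ * (1 - lam) * ((1 - u ^ 2) / (1 - 2 * u * Real.cos φ + u ^ 2) *
            Real.log (p ^ 2 + 2 * p * q * Real.cos φ + q ^ 2)) -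
          (1 - θ - lam * θ) * ((1 - w ^ 2) / (1 - 2 * w * Real.cos φ + w ^ 2) *
            Real.log (p ^ 2 + 2 * p * q * Real.cos φ + q ^ 2))) := by
    intro φ hφ
    rw [Set.uIcc_of_le Real.pi_pos.le] at hφ
    have hsin := Real.sin_nonneg_of_nonneg_of_le_pi hφ.1 hφ.2
    have hx := sq_add_two_mul_cos_add_sq_pos hqp φ
    have hden := sq_add_two_mul_cos_add_sq_pos (p := 1) (q := -w) (by rwa [abs_neg]) φ
    have hsc := Real.sin_sq_add_cos_sq φ
    have hgx := hg (p ^ 2 + q ^ 2 + 2 * p * q * Real.cos φ)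
    rw [show (p ^ 2 + q ^ 2 + 2 * p * q * Real.cos φ - xm) *
        (xp - (p ^ 2 + q ^ 2 + 2 * p * q * Real.cos φ)) = (2 * p * q * Real.sin φ) ^ 2 by
      rw [hxp', hxm']; linear_combination -(2 * p * q) ^ 2 * hsc,
      Real.sqrt_sq (by positivity)] at hgx
    rw [hgx]
    rw [show p ^ 2 + q ^ 2 + 2 * p * q * Real.cos φ = p ^ 2 + 2 * p * q * Real.cos φ + q ^ 2 by ring]
    generalize Real.cos φ = c at *
    generalize Real.sin φ = s at *
    obtain ⟨x, hxdef⟩ : ∃ x, x = p ^ 2 + 2 * p * q * c + q ^ 2 := ⟨_, rfl⟩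
    rw [← hxdef] at hx ⊢
    have h1x : 1 - x = R * (1 - 2 * w * c + w ^ 2) := by
      rw [hxdef]
      linear_combination 2 * c * hwR - hw2 - hp2 - hq2 + hRdef
    have hwden : 0 < 1 - 2 * w * c + w ^ 2 := by linarith
    have h1x0 : 0 < 1 - x := by rw [h1x]; positivity
    have hU : (1 - u ^ 2) / (1 - 2 * u * c + u ^ 2) = θ * (1 - lam) / x := by
      have e : x = p ^ 2 * (1 - 2 * u * c + u ^ 2) := by
        rw [hxdef]
        linear_combination (2 * p * c - p * u + q) * hup
      have e0 : 1 - 2 * u * c + u ^ 2 ≠ 0 := by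
        intro h0
        rw [h0, mul_zero] at e
        exact hx.ne' e
      rw [e, div_eq_div_iff e0 (by positivity)]
      linear_combination (1 - 2 * u * c + u ^ 2) * (hp2 - hq2 - (p * u - q) * hup)
    have hW : (1 - w ^ 2) / (1 - 2 * w * c + w ^ 2) = (1 - θ - lam * θ) / (1 - x) := by
      rw [h1x, div_eq_div_iff hwden.ne' (by positivity)]
      linear_combination (1 - 2 * w * c + w ^ 2) * (-hw2 - hRdef)
    have hnum : (2 * p * q * s) ^ 2 = x * (1 - x) - (θ * (1 - lam)) ^ 2 * (1 - x)
        - (1 - θ - lam * θ) ^ 2 * x := by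
      linear_combination (2 * p * q) ^ 2 * hsc + (x - p ^ 2 - q ^ 2 + 2 * p * q * c) * hxdef +
        2 * x * (hp2 + hq2) - (p ^ 2 - q ^ 2 + θ * (1 - lam)) * (hp2 - hq2)
    rw [hU, hW]
    have hπ := Real.pi_pos
    field_simp
    linear_combination Real.log x * hnum
  have hI0 := integral_zero_pi_poissonKernel_mul_log hqp h01
  have hIu := integral_zero_pi_poissonKernel_mul_log hqp hu1
  have hIw := integral_zero_pi_poissonKernel_mul_log hqp hw1
  have hC0 := (continuous_poissonKernel_mul_log hqp h01).intervalIntegrable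
    (μ := MeasureTheory.volume) 0 Real.pi
  have hCu := ((continuous_poissonKernel_mul_log hqp hu1).intervalIntegrable
    (μ := MeasureTheory.volume) 0 Real.pi).const_mul (θ * (1 - lam))
  have hCw := ((continuous_poissonKernel_mul_log hqp hw1).intervalIntegrable
    (μ := MeasureTheory.volume) 0 Real.pi).const_mul (1 - θ - lam * θ)
  have hvu : Real.log (p + q * u) = Real.log (θ * (1 - lam)) - Real.log p := by
    rw [← Real.log_div hD.ne' hp.ne']
    congr 1
    rw [hu]
    field_simp
    linear_combination hp2 - hq2
  have hvw : Real.log (p + q * w) = Real.log θ - Real.log p := by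
    rw [← Real.log_div hθ0.ne' hp.ne']
    congr 1
    rw [eq_div_iff hp.ne']
    apply mul_left_cancel₀ hR.ne'
    linear_combination R * hp2 + p * q * hwR + q ^ 2 * hp2 + θ * (1 - lam * θ) * hq2
      + lam * θ ^ 2 * hRdef
  rw [hxp', hxm', integral_sub_add_eq_integral_cos (by positivity),
    intervalIntegral.integral_congr hpt, intervalIntegral.integral_const_mul,
    intervalIntegral.integral_sub (hC0.sub hCu) hCw, intervalIntegral.integral_sub hC0 hCu,
    intervalIntegral.integral_const_mul, intervalIntegral.integral_const_mul, hI0, hIu, hIw,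
    hvu, hvw, mul_zero, add_zero, hlogp]
  have hπ := Real.pi_pos
  field_simp
  ring
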